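/- arXiv:2401.06073 — 6 statements merged into one kernel-verified Lean document; each statement's English description precedes it below -/
import Mathlib

section
/- Let κ be a Markov kernel on ℝ such that: (i) for every x ∈ ℝ the measure κ(x,·) has finite first moment with ∫ a κ(x, da) = x; (ii) there is η > 0 with sup_{x∈ℝ} ∫ e^{η|a−x|} κ(x, da) < ∞; and (iii) inf_{x∈ℝ} ∫ (a − x)² κ(x, da) > 0. Then the function V(x) := √(|x| + 1) satisfies a Foster–Lyapunov drift condition: there exists R > 0 such that ∫ V(a) κ(x, da) ≤ V(x) for every x with |x| ≥ R. In particular V is a nonnegative function with compact sublevel sets satisfying κV ≤ V outside a compact interval. -/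
open MeasureTheory ProbabilityTheory
open scoped ENNReal

lemma sqrt_one_add_le_cubic {t : ℝ} (ht : -1 ≤ t) :
    √(1 + t) ≤ 1 + t / 2 - t ^ 2 / 8 + t ^ 3 / 16 := by
  rw [Real.sqrt_le_iff]
  constructor
  · nlinarith [mul_nonneg (by linarith : 0 ≤ t + 1) (sq_nonneg (t - 1)),
      mul_nonneg (by linarith : 0 ≤ t + 1) (sq_nonneg t), sq_nonneg (t - 1)]
  · have h : 0 ≤ t ^ 4 * ((t - 2) ^ 2 + 16) := by positivity
    linear_combination h / 256

/-- Third-order upper bound for `√(|y + h| + 1)` around a base point `y ≥ 1`, uniform in `h`. -/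
lemma sqrt_abs_add_one_le_of_one_le {y : ℝ} (hy : 1 ≤ y) (h : ℝ) :
    √(|y + h| + 1) ≤ √(y + 1) * (1 + h / (y + 1) / 2 - (h / (y + 1)) ^ 2 / 8
      + 8 * |h / (y + 1)| ^ 3) := by
  have hs : 0 < y + 1 := by linarith
  obtain ⟨t, rfl⟩ : ∃ t, h = t * (y + 1) := ⟨h / (y + 1), by field_simp⟩
  rw [mul_div_cancel_right₀ _ hs.ne']
  have habs : |y + t * (y + 1)| + 1 = (y + 1) * ((|y + t * (y + 1)| + 1) / (y + 1)) := by
    field_simp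
  rw [habs, Real.sqrt_mul hs.le]
  refine mul_le_mul_of_nonneg_left ?_ (Real.sqrt_nonneg _)
  rcases le_total 0 (y + t * (y + 1)) with ha | ha
  · have ht : -1 ≤ t := by nlinarith
    have heq : (|y + t * (y + 1)| + 1) / (y + 1) = 1 + t := by
      rw [abs_of_nonneg ha]; field_simp; ring
    rw [heq]
    have h3 : t ^ 3 ≤ |t| ^ 3 := by
      rw [← abs_pow]; exact le_abs_self _
    have h0 : 0 ≤ |t| ^ 3 := by positivity
    linarith [sqrt_one_add_le_cubic ht]
  · have ht : t ≤ -(1 / 2) := by nlinarith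
    have hle : (|y + t * (y + 1)| + 1) / (y + 1) ≤ -t := by
      rw [abs_of_nonpos ha, div_le_iff₀ hs]; linarith
    rw [abs_of_nonpos (by linarith : t ≤ 0)]
    obtain ⟨v, rfl⟩ : ∃ v, t = -(v + 1 / 2) := ⟨-t - 1 / 2, by ring⟩
    have hv : 0 ≤ v := by linarith
    refine Real.sqrt_le_iff.2 ⟨?_, ?_⟩
    · nlinarith [pow_nonneg hv 3, pow_nonneg hv 2]
    · have hlow : v + 1 / 2 + 1 / 4 ≤ 1 + -(v + 1 / 2) / 2 - (-(v + 1 / 2)) ^ 2 / 8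
          + 8 * (-(-(v + 1 / 2))) ^ 3 := by
        nlinarith [pow_nonneg hv 3, pow_nonneg hv 2]
      nlinarith [pow_le_pow_left₀ (by linarith) hlow 2, sq_nonneg (v + 1 / 4)]

/-- Third-order upper bound for `√(|a| + 1)` around a base point `x` with `1 ≤ |x|`. -/
lemma sqrt_abs_add_one_le {x : ℝ} (hx : 1 ≤ |x|) (a : ℝ) :
    √(|a| + 1) ≤ √(|x| + 1) * (1 + SignType.sign x * (a - x) / (|x| + 1) / 2
      - (a - x) ^ 2 / (|x| + 1) ^ 2 / 8 + 8 * (|a - x| ^ 3 / (|x| + 1) ^ 3)) := by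
  have hs : 0 < |x| + 1 := by positivity
  rcases lt_trichotomy x 0 with h | rfl | h
  · have := sqrt_abs_add_one_le_of_one_le hx (-(a - x))
    have e : |x| + -(a - x) = -a := by rw [abs_of_neg h]; ring
    rw [e, abs_neg] at this
    simpa [h, abs_div, abs_of_pos hs, div_pow, abs_sub_comm, sub_sq_comm a x] using this
  · norm_num at hx
  · have := sqrt_abs_add_one_le_of_one_le hx (a - x)
    have e : |x| + (a - x) = a := by rw [abs_of_pos h]; ring
    rw [e] at this
    simpa [h, abs_div, abs_of_pos hs, div_pow] using this

lemma abs_pow_le_exp_mul {η : ℝ} (hη : 0 < η) (n : ℕ) (u : ℝ) :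
    |u| ^ n ≤ n.factorial / η ^ n * Real.exp (η * |u|) := by
  have h := Real.pow_div_factorial_le_exp (η * |u|) (by positivity) n
  rw [div_le_iff₀ (by positivity), mul_pow] at h
  rw [div_mul_eq_mul_div, le_div_iff₀ (by positivity)]
  linarith

/-- Foster–Lyapunov drift condition for a mean-preserving kernel on `ℝ` with uniform
exponential moments and uniformly non-degenerate variance: `V(x) = √(|x| + 1)` satisfies
`κV(x) ≤ V(x)` for all `x` outside a compact interval. -/
theorem foster_lyapunov_sqrt_drift
    (κ : Kernel ℝ ℝ) [IsMarkovKernel κ]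
    (hint : ∀ x : ℝ, Integrable (fun a => a) (κ x))
    (hmean : ∀ x : ℝ, (∫ a, a ∂(κ x)) = x)
    (η : ℝ) (hη : 0 < η) (Cexp : ℝ)
    (hexp : ∀ x : ℝ,
      ∫⁻ a, ENNReal.ofReal (Real.exp (η * |a - x|)) ∂(κ x) ≤ ENNReal.ofReal Cexp)
    (δ : ℝ) (hδ : 0 < δ)
    (hvar : ∀ x : ℝ, δ ≤ ∫ a, (a - x) ^ 2 ∂(κ x)) :
    ∃ R : ℝ, 0 < R ∧ ∀ x : ℝ, R ≤ |x| →
      (∫ a, Real.sqrt (|a| + 1) ∂(κ x)) ≤ Real.sqrt (|x| + 1) := by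
  set M : ℝ := Nat.factorial 3 / η ^ 3 * max Cexp 0
  have hM0 : 0 ≤ M := by positivity
  refine ⟨1 + 64 * M / δ, by positivity, fun x hx => ?_⟩
  have hx1 : 1 ≤ |x| := le_trans (le_add_of_nonneg_right (by positivity)) hx
  have hexp_int : Integrable (fun a => Real.exp (η * |a - x|)) (κ x) := by
    refine ⟨by fun_prop, ?_⟩
    rw [hasFiniteIntegral_iff_ofReal (.of_forall fun _ => (Real.exp_pos _).le)]
    exact (hexp x).trans_lt ENNReal.ofReal_lt_top
  have hexp_le : ∫ a, Real.exp (η * |a - x|) ∂(κ x) ≤ max Cexp 0 := by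
    rw [integral_eq_lintegral_of_nonneg_ae (.of_forall fun _ => (Real.exp_pos _).le) (by fun_prop),
      ← ENNReal.toReal_ofReal']
    exact ENNReal.toReal_mono ENNReal.ofReal_ne_top (hexp x)
  have habs_int (n : ℕ) : Integrable (fun a => |a - x| ^ n) (κ x) := by
    refine (hexp_int.const_mul (n.factorial / η ^ n)).mono' (by fun_prop) (.of_forall fun a => ?_)
    rw [Real.norm_of_nonneg (by positivity)]
    exact abs_pow_le_exp_mul hη n _
  have hsq_int : Integrable (fun a => (a - x) ^ 2) (κ x) := by simpa using habs_int 2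
  have hcube : ∫ a, |a - x| ^ 3 ∂(κ x) ≤ M := by
    calc ∫ a, |a - x| ^ 3 ∂(κ x)
        ≤ ∫ a, Nat.factorial 3 / η ^ 3 * Real.exp (η * |a - x|) ∂(κ x) :=
          integral_mono (habs_int 3) (hexp_int.const_mul _) fun a => abs_pow_le_exp_mul hη 3 _
      _ ≤ M := by
          rw [integral_const_mul]
          exact mul_le_mul_of_nonneg_left hexp_le (by positivity)
  have hlin_int : Integrable (fun a => a - x) (κ x) := (hint x).sub (integrable_const x)
  have hlin : ∫ a, (a - x) ∂(κ x) = 0 := by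
    rw [integral_sub (hint x) (integrable_const x), hmean x]; simp
  set s : ℝ := |x| + 1
  have hs0 : 0 < s := by positivity
  set σ : ℝ := (SignType.sign x : ℝ)
  have i1 : Integrable (fun a => 1 + σ * (a - x) / s / 2) (κ x) :=
    (integrable_const _).add (((hlin_int.const_mul _).div_const _).div_const _)
  have i2 : Integrable (fun a => (a - x) ^ 2 / s ^ 2 / 8) (κ x) :=
    (hsq_int.div_const _).div_const _
  have i12 : Integrable (fun a => 1 + σ * (a - x) / s / 2 - (a - x) ^ 2 / s ^ 2 / 8) (κ x) :=
    i1.sub i2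
  have i3 : Integrable (fun a => 8 * (|a - x| ^ 3 / s ^ 3)) (κ x) :=
    ((habs_int 3).div_const _).const_mul _
  have hgap : 8 * (M / s ^ 3) ≤ δ / s ^ 2 / 8 := by
    have h64 : 64 * M ≤ δ * s := by
      have : 64 * M / δ ≤ s := by linarith
      rw [div_le_iff₀ hδ] at this
      linarith
    have e : δ / s ^ 2 / 8 - 8 * (M / s ^ 3) = (δ * s - 64 * M) / (8 * s ^ 3) := by
      field_simp
      ring
    have : 0 ≤ (δ * s - 64 * M) / (8 * s ^ 3) := div_nonneg (by linarith) (by positivity)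
    linarith
  calc ∫ a, √(|a| + 1) ∂(κ x)
      ≤ ∫ a, √s * (1 + σ * (a - x) / s / 2 - (a - x) ^ 2 / s ^ 2 / 8
          + 8 * (|a - x| ^ 3 / s ^ 3)) ∂(κ x) :=
        integral_mono_of_nonneg (.of_forall fun _ => Real.sqrt_nonneg _)
          ((i12.add i3).const_mul _) (.of_forall fun a => sqrt_abs_add_one_le hx1 a)
    _ = √s * (1 - (∫ a, (a - x) ^ 2 ∂(κ x)) / s ^ 2 / 8
          + 8 * ((∫ a, |a - x| ^ 3 ∂(κ x)) / s ^ 3)) := by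
        rw [integral_const_mul, integral_add i12 i3, integral_sub i1 i2,
          integral_add (integrable_const _) (((hlin_int.const_mul _).div_const _).div_const _)]
        simp only [integral_const_mul, integral_div, hlin]
        simp
    _ ≤ √s * 1 := by
        refine mul_le_mul_of_nonneg_left ?_ (Real.sqrt_nonneg _)
        have h2 : δ / s ^ 2 / 8 ≤ (∫ a, (a - x) ^ 2 ∂(κ x)) / s ^ 2 / 8 := by
          have := hvar x
          gcongr
        have h3 : 8 * ((∫ a, |a - x| ^ 3 ∂(κ x)) / s ^ 3) ≤ 8 * (M / s ^ 3) := by gcongr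
        linarith
    _ = √s := mul_one _
end

section
/- Let η > 0 and let κ be a Markov kernel on ℝ such that ∫ a κ(x, da) = x for every x ∈ ℝ and sup_{x∈ℝ} ∫ e^{η|a−x|} κ(x, da) < ∞. Then for every C > 0 there exists C' > 0 such that, uniformly over all Borel measurable f : ℝ → ℝ, all b, x ∈ ℝ, and all θ ∈ (0, η/2]: if |f(y) − |y − b|| ≤ C e^{−θ|y−b|} for every y ∈ ℝ, then | ∫ f(a) κ(x, da) − f(x) | ≤ C' θ^{−1} e^{−θ|x−b|}. -/
/-- Pointwise bound: after subtracting a linear term of slope `σ = ±1`, the increments of a function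
exponentially close to `y ↦ |y - b|` are controlled by `exp (η |a - x|)`. -/
theorem abs_sub_sub_mul_le_of_near_absolute_value {η θ C b x σ : ℝ} {f : ℝ → ℝ}
    (hC : 0 ≤ C) (hθ : 0 < θ) (hθη : θ ≤ η / 2)
    (hσ : σ = 1 ∧ 0 ≤ x - b ∨ σ = -1 ∧ x - b ≤ 0)
    (hf : ∀ y : ℝ, |(f y - |y - b|)| ≤ C * Real.exp (-θ * |y - b|)) (a : ℝ) :
    |f a - f x - σ * (a - x)| ≤
      (C * η + 2) * θ⁻¹ * Real.exp (-θ * |x - b|) * Real.exp (η * |a - x|) := by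
  have hη : 0 < η := by linarith
  set E := Real.exp (-θ * |x - b|)
  set G := Real.exp (η * |a - x|)
  have hE : 0 < E := Real.exp_pos _
  have hG : 1 ≤ G := Real.one_le_exp (by positivity)
  have hfa : C * Real.exp (-θ * |a - b|) ≤ C * (E * G) := by
    rw [← Real.exp_add]
    gcongr
    have h1 : |x - b| ≤ |a - x| + |a - b| := by
      rw [abs_sub_comm a x]; exact abs_sub_le x a b
    nlinarith [mul_le_mul_of_nonneg_left h1 hθ.le,
      mul_le_mul_of_nonneg_right (show θ ≤ η by linarith) (abs_nonneg (a - x))]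
  have hfx : C * E ≤ C * (E * G) := by
    gcongr
    exact le_mul_of_one_le_right hE.le hG
  have hlin : |(|a - b| - |x - b| - σ * (a - x))| ≤ 2 * θ⁻¹ * (E * G) := by
    rcases le_or_gt |a - x| |x - b| with h | h
    · have h0 : |a - b| - |x - b| - σ * (a - x) = 0 := by
        rcases hσ with ⟨rfl, hs⟩ | ⟨rfl, hs⟩
        · rw [abs_of_nonneg hs] at h ⊢
          rw [abs_of_nonneg (by linarith [neg_abs_le (a - x)])]
          ring
        · rw [abs_of_nonpos hs] at h ⊢
          rw [abs_of_nonpos (by linarith [le_abs_self (a - x)])]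
          ring
      rw [h0, abs_zero]
      positivity
    · have h2 : |(|a - b| - |x - b| - σ * (a - x))| ≤ 2 * |a - x| := by
        have h3 : |(|a - b| - |x - b|)| ≤ |a - x| := by
          simpa using abs_abs_sub_abs_le_abs_sub (a - b) (x - b)
        have h4 : |σ * (a - x)| = |a - x| := by
          rcases hσ with ⟨rfl, -⟩ | ⟨rfl, -⟩ <;> simp [abs_sub_comm]
        linarith [abs_sub (|a - b| - |x - b|) (σ * (a - x))]
      have h5 : θ * |a - x| ≤ E * G := by
        rw [← Real.exp_add]
        refine le_trans ?_ (Real.add_one_le_exp _)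
        nlinarith [mul_le_mul_of_nonneg_left h.le hθ.le,
          mul_le_mul_of_nonneg_right (show 2 * θ ≤ η by linarith) (abs_nonneg (a - x))]
      have h6 : |a - x| ≤ θ⁻¹ * (E * G) := by
        rw [inv_mul_eq_div, le_div_iff₀ hθ]
        linarith
      linarith
  have hsplit : f a - f x - σ * (a - x) =
      (f a - |a - b|) - (f x - |x - b|) + (|a - b| - |x - b| - σ * (a - x)) := by ring
  have hη2 : 2 * C ≤ C * η * θ⁻¹ := by
    rw [← div_eq_mul_inv, le_div_iff₀ hθ]
    nlinarith
  calc |f a - f x - σ * (a - x)|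
      ≤ 2 * C * (E * G) + 2 * θ⁻¹ * (E * G) := by
        rw [hsplit]
        refine (abs_add_le _ _).trans ?_
        linarith [abs_sub (f a - |a - b|) (f x - |x - b|), hf a, hf x]
    _ ≤ C * η * θ⁻¹ * (E * G) + 2 * θ⁻¹ * (E * G) := by gcongr
    _ = (C * η + 2) * θ⁻¹ * E * G := by ring


open MeasureTheory ProbabilityTheory
open scoped ENNReal

/-- For a mean-preserving kernel on `ℝ` with uniform exponential moments, the drift
`(κ f)(x) - f(x)` of any function `f` which is exponentially close to `y ↦ |y - b|` is
exponentially small in `|x - b|`, with constant `C' θ⁻¹` uniform in `f`, `b`, `x`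
and `θ ∈ (0, η/2]`. -/
theorem kernel_drift_of_near_absolute_value
    (η : ℝ) (hη : 0 < η)
    (κ : Kernel ℝ ℝ) [IsMarkovKernel κ]
    (hmean : ∀ x : ℝ, (∫ a, a ∂(κ x)) = x)
    (Cexp : ℝ)
    (hexp : ∀ x : ℝ,
      ∫⁻ a, ENNReal.ofReal (Real.exp (η * |a - x|)) ∂(κ x) ≤ ENNReal.ofReal Cexp) :
    ∀ C : ℝ, 0 < C → ∃ C' : ℝ, 0 < C' ∧
      ∀ f : ℝ → ℝ, Measurable f → ∀ b x θ : ℝ, 0 < θ → θ ≤ η / 2 →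
      (∀ y : ℝ, abs (f y - |y - b|) ≤ C * Real.exp (-θ * |y - b|)) →
      |(∫ a, f a ∂(κ x)) - f x| ≤ C' * θ⁻¹ * Real.exp (-θ * |x - b|) := by
  intro C hC
  refine ⟨(C * η + 2) * max Cexp 1, by positivity, fun f hfm b x θ hθ hθη hf => ?_⟩
  have hGm : Measurable fun a : ℝ => Real.exp (η * |a - x|) := by fun_prop
  have hGi : Integrable (fun a => Real.exp (η * |a - x|)) (κ x) :=
    ⟨hGm.aestronglyMeasurable, by
      rw [hasFiniteIntegral_iff_ofReal (.of_forall fun a => (Real.exp_pos _).le)]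
      exact (hexp x).trans_lt ENNReal.ofReal_lt_top⟩
  have hGle : ∫ a, Real.exp (η * |a - x|) ∂(κ x) ≤ max Cexp 1 := by
    rw [integral_eq_lintegral_of_nonneg_ae (.of_forall fun a => (Real.exp_pos _).le)
      hGm.aestronglyMeasurable]
    refine ENNReal.toReal_le_of_le_ofReal (by positivity) ((hexp x).trans ?_)
    exact ENNReal.ofReal_le_ofReal (le_max_left _ _)
  have hui : Integrable (fun a : ℝ => a - x) (κ x) := by
    refine (hGi.const_mul η⁻¹).mono' (by fun_prop) (.of_forall fun a => ?_)
    rw [Real.norm_eq_abs, inv_mul_eq_div, le_div_iff₀ hη]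
    linarith [Real.add_one_le_exp (η * |a - x|)]
  have hu0 : ∫ a, (a - x) ∂(κ x) = 0 := by
    have hid : Integrable (fun a : ℝ => a) (κ x) := by
      refine (hui.add (integrable_const x)).congr (.of_forall fun a => ?_)
      simp
    rw [integral_sub hid (integrable_const x), hmean]
    simp
  obtain ⟨σ, hσ⟩ : ∃ σ : ℝ, σ = 1 ∧ 0 ≤ x - b ∨ σ = -1 ∧ x - b ≤ 0 := by
    rcases le_total 0 (x - b) with h | h
    · exact ⟨1, .inl ⟨rfl, h⟩⟩
    · exact ⟨-1, .inr ⟨rfl, h⟩⟩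
  have hbound := abs_sub_sub_mul_le_of_near_absolute_value hC.le hθ hθη hσ hf
  set D := (C * η + 2) * θ⁻¹ * Real.exp (-θ * |x - b|) with hD
  have hDpos : 0 ≤ D := by positivity
  have hgi : Integrable (fun a => f a - f x - σ * (a - x)) (κ x) :=
    (hGi.const_mul D).mono' (by fun_prop) (.of_forall hbound)
  have hfi : Integrable f (κ x) := by
    refine ((hgi.add (hui.const_mul σ)).add (integrable_const (f x))).congr
      (.of_forall fun a => ?_)
    simp
  have hfx : Integrable (fun a => f a - f x) (κ x) := hfi.sub (integrable_const _)
  have hint : (∫ a, f a ∂(κ x)) - f x = ∫ a, (f a - f x - σ * (a - x)) ∂(κ x) := by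
    rw [integral_sub hfx (hui.const_mul σ), integral_const_mul, hu0,
      integral_sub hfi (integrable_const _)]
    simp
  rw [hint, ← Real.norm_eq_abs]
  calc ‖∫ a, (f a - f x - σ * (a - x)) ∂(κ x)‖
      ≤ ∫ a, D * Real.exp (η * |a - x|) ∂(κ x) :=
        norm_integral_le_of_norm_le (hGi.const_mul D) (.of_forall hbound)
    _ ≤ D * max Cexp 1 := by
        rw [integral_const_mul]
        gcongr
    _ = (C * η + 2) * max Cexp 1 * θ⁻¹ * Real.exp (-θ * |x - b|) := by
        rw [hD]
        ring
end

section
/- Let (Ω, 𝔉, P) be a probability space and let w be a random tempered distribution on ℝ, i.e. w : Ω → 𝒮'(ℝ) such that ω ↦ ⟨w(ω), φ⟩ is measurable for every Schwartz function φ. Let φ ∈ 𝒮(ℝ) be a fixed even function with ∫ φ(x) dx = 1, and for a ∈ ℝ and ε > 0 set φ_ε^a(x) := ε^{−1} φ(ε^{−1}(x − a)). Assume there exist δ ∈ (0,1) and C < ∞ such that E[ ⟨w, φ_ε^a⟩² ] ≤ C · max(1, |a|^{δ−1}) for all a ∈ ℝ ∖ {0} and all ε ∈ (0,1], and that lim_{ε→0}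 E[ ⟨w, φ_ε^a⟩² ] = 0 for every a ∈ ℝ ∖ {0}. Then for every ψ ∈ 𝒮(ℝ), ⟨w, ψ⟩ = 0 almost surely. -/
open MeasureTheory
open Filter Topology SchwartzMap

namespace SchwartzMap

lemma abs_le_one_add_abs_mul (x y a : ℝ) (h : |x - y| ≤ |a|) :
    |x| ≤ (1 + |a|) * (1 + |y|) := by
  have h1 : |x| ≤ |x - y| + |y| := by simpa using abs_add_le (x - y) y
  nlinarith [mul_nonneg (abs_nonneg a) (abs_nonneg y)]

lemma pow_abs_mul_iteratedDeriv_le (k n : ℕ) (f : 𝓢(ℝ, ℝ)) (x y a : ℝ) (h : |x - y| ≤ |a|) :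
    |x| ^ k * ‖iteratedDeriv n f y‖ ≤
      (1 + |a|) ^ k * (2 ^ k * ((Finset.Iic (k, n)).sup fun m => SchwartzMap.seminorm ℝ m.1 m.2) f) := by
  have h1 := one_add_le_sup_seminorm_apply (𝕜 := ℝ) (m := (k, n)) le_rfl le_rfl f y
  rw [norm_iteratedFDeriv_eq_norm_iteratedDeriv] at h1
  calc |x| ^ k * ‖iteratedDeriv n f y‖
      ≤ ((1 + |a|) * (1 + |y|)) ^ k * ‖iteratedDeriv n f y‖ := by
        gcongr; exact abs_le_one_add_abs_mul x y a h
    _ = (1 + |a|) ^ k * ((1 + ‖y‖) ^ k * ‖iteratedDeriv n f y‖) := by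
        rw [mul_pow, Real.norm_eq_abs y]; ring
    _ ≤ _ := by gcongr

lemma iteratedDeriv_compSubConstCLM (n : ℕ) (f : 𝓢(ℝ, ℝ)) (a x : ℝ) :
    iteratedDeriv n (f.compSubConstCLM ℝ a) x = iteratedDeriv n f (x - a) :=
  congrFun (iteratedDeriv_comp_sub_const n f a) x

lemma seminorm_compSubConstCLM_le (k n : ℕ) (f : 𝓢(ℝ, ℝ)) (a : ℝ) :
    SchwartzMap.seminorm ℝ k n (f.compSubConstCLM ℝ a) ≤
      (1 + |a|) ^ k *
        (2 ^ k * ((Finset.Iic (k, n)).sup fun m => SchwartzMap.seminorm ℝ m.1 m.2) f) := by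
  refine seminorm_le_bound' ℝ k n _ (by positivity) fun x => ?_
  rw [iteratedDeriv_compSubConstCLM]
  exact pow_abs_mul_iteratedDeriv_le k n f x (x - a) a (by simp)

lemma seminorm_compSubConstCLM_sub_le (k n : ℕ) (f : 𝓢(ℝ, ℝ)) (a : ℝ) :
    SchwartzMap.seminorm ℝ k n (f.compSubConstCLM ℝ a - f) ≤
      (1 + |a|) ^ k *
        (2 ^ k * ((Finset.Iic (k, n + 1)).sup fun m => SchwartzMap.seminorm ℝ m.1 m.2) f) * |a| := by
  refine seminorm_le_bound' ℝ k n _ (by positivity) fun x => ?_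
  have hd : iteratedDeriv n (f.compSubConstCLM ℝ a - f) x =
      iteratedDeriv n f (x - a) - iteratedDeriv n f x := by
    rw [FunLike.coe_sub, iteratedDeriv_sub (((f.compSubConstCLM ℝ a).smooth n).contDiffAt)
      ((f.smooth n).contDiffAt), iteratedDeriv_compSubConstCLM]
  rw [hd]
  have hderiv : ∀ y, HasDerivAt (iteratedDeriv n f) (iteratedDeriv (n + 1) f y) y := fun y => by
    rw [iteratedDeriv_succ]
    exact ((f.smooth (n + 1)).differentiable_iteratedDeriv n
      (by exact_mod_cast Nat.lt_succ_self n) y).hasDerivAt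
  have := Convex.norm_image_sub_le_of_norm_hasDerivWithin_le
    (f := fun y => |x| ^ k * iteratedDeriv n f y)
    (f' := fun y => |x| ^ k * iteratedDeriv (n + 1) f y) (s := Set.uIcc x (x - a))
    (x := x) (y := x - a)
    (C := (1 + |a|) ^ k *
        (2 ^ k * ((Finset.Iic (k, n + 1)).sup fun m => SchwartzMap.seminorm ℝ m.1 m.2) f))
    (fun y _ => ((hderiv y).const_mul _).hasDerivWithinAt)
    (fun y hy => by
      rw [norm_mul, norm_pow, Real.norm_eq_abs, abs_abs]
      refine pow_abs_mul_iteratedDeriv_le k (n + 1) f x y a ?_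
      have := Set.abs_sub_left_of_mem_uIcc hy
      rw [abs_sub_comm]
      simpa using this)
    (convex_uIcc _ _) Set.left_mem_uIcc Set.right_mem_uIcc
  rw [← mul_sub, norm_mul, norm_pow, Real.norm_eq_abs, abs_abs] at this
  simpa using this

lemma continuous_compSubConstCLM (f : 𝓢(ℝ, ℝ)) :
    Continuous fun a : ℝ => f.compSubConstCLM ℝ a := by
  have h0 : Tendsto (fun a : ℝ => f.compSubConstCLM ℝ a) (𝓝 0) (𝓝 f) := by
    rw [(schwartz_withSeminorms ℝ ℝ ℝ).tendsto_nhds]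
    rintro ⟨k, n⟩ ε hε
    have hc : Tendsto (fun a : ℝ => (1 + |a|) ^ k *
        (2 ^ k * ((Finset.Iic (k, n + 1)).sup fun m => SchwartzMap.seminorm ℝ m.1 m.2) f) * |a|)
        (𝓝 0) (𝓝 0) := by
      have : Continuous (fun a : ℝ => (1 + |a|) ^ k *
        (2 ^ k * ((Finset.Iic (k, n + 1)).sup fun m => SchwartzMap.seminorm ℝ m.1 m.2) f) * |a|) := by
        fun_prop
      simpa using this.tendsto 0
    filter_upwards [hc.eventually_lt_const hε] with a ha
    exact (seminorm_compSubConstCLM_sub_le k n f a).trans_lt ha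
  refine continuous_iff_continuousAt.2 fun a => ?_
  have h1 : Tendsto (fun b : ℝ => b - a) (𝓝 a) (𝓝 0) := by
    simpa using (continuous_sub_right a).tendsto a
  have h2 := ((compSubConstCLM ℝ a).continuous.tendsto f).comp (h0.comp h1)
  refine h2.congr fun b => ?_
  simp

/-- Continuous linear maps from Schwartz space grow at most polynomially along translates. -/
lemma exists_norm_compSubConstCLM_le {E : Type*} [NormedAddCommGroup E] [NormedSpace ℝ E]
    (u : 𝓢(ℝ, ℝ) →L[ℝ] E) (f : 𝓢(ℝ, ℝ)) :
    ∃ (M : ℝ) (N : ℕ), 0 ≤ M ∧ ∀ a : ℝ, ‖u (f.compSubConstCLM ℝ a)‖ ≤ M * (1 + |a|) ^ N := by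
  obtain ⟨s, C, -, hC⟩ := Seminorm.bound_of_continuous (schwartz_withSeminorms ℝ ℝ ℝ)
    ((normSeminorm ℝ E).comp u.toLinearMap) (continuous_norm.comp u.continuous)
  refine ⟨C * ∑ m ∈ s, (2 ^ m.1 *
    ((Finset.Iic (m.1, m.2)).sup fun m => SchwartzMap.seminorm ℝ m.1 m.2) f), s.sup Prod.fst,
    by positivity, fun a => ?_⟩
  have h1 : ‖u (f.compSubConstCLM ℝ a)‖ ≤
      C * (s.sup (schwartzSeminormFamily ℝ ℝ ℝ)) (f.compSubConstCLM ℝ a) :=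
    hC (f.compSubConstCLM ℝ a)
  refine h1.trans ?_
  rw [mul_assoc]
  gcongr
  refine (Seminorm.finset_sup_le_sum _ s (f.compSubConstCLM ℝ a)).trans ?_
  rw [Finset.sum_mul]
  have hcoe : ∀ t : Finset (ℕ × ℕ), ∀ g : 𝓢(ℝ, ℝ),
      (∑ i ∈ t, schwartzSeminormFamily ℝ ℝ ℝ i) g = ∑ i ∈ t, schwartzSeminormFamily ℝ ℝ ℝ i g := by
    intro t g
    induction t using Finset.induction_on with
    | empty => simp
    | insert i t hi ih => rw [Finset.sum_insert hi, Finset.sum_insert hi, add_apply, ih]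
  rw [hcoe]
  refine Finset.sum_le_sum fun m hm => ?_
  rw [mul_comm _ ((1 + |a|) ^ s.sup Prod.fst)]
  refine (seminorm_compSubConstCLM_le m.1 m.2 f a).trans ?_
  gcongr
  · simp
  · exact Finset.le_sup (f := Prod.fst) hm

lemma integrable_mul_one_add_abs_pow (g : 𝓢(ℝ, ℝ)) (N : ℕ) :
    Integrable fun a : ℝ => ‖g a‖ * (1 + |a|) ^ N := by
  have : ∀ a : ℝ, ‖g a‖ * (1 + |a|) ^ N =
      ∑ m ∈ Finset.range (N + 1), (N.choose m : ℝ) * (‖a‖ ^ (N - m) * ‖g a‖) := fun a => by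
    rw [add_pow, Finset.mul_sum]
    refine Finset.sum_congr rfl fun m _ => ?_
    simp; ring
  simp_rw [this]
  exact integrable_finsetSum _ fun m _ => (g.integrable_pow_mul volume (N - m)).const_mul _

lemma integrable_smul_compSubConstCLM {E : Type*} [NormedAddCommGroup E] [NormedSpace ℝ E]
    (u : 𝓢(ℝ, ℝ) →L[ℝ] E) (f g : 𝓢(ℝ, ℝ)) :
    Integrable fun a : ℝ => g a • u (f.compSubConstCLM ℝ a) := by
  obtain ⟨M, N, hM, h⟩ := exists_norm_compSubConstCLM_le u f
  refine ((integrable_mul_one_add_abs_pow g N).const_mul M).mono'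
    (g.continuous.smul (u.continuous.comp f.continuous_compSubConstCLM)).aestronglyMeasurable ?_
  refine .of_forall fun a => ?_
  rw [norm_smul]
  nlinarith [mul_le_mul_of_nonneg_left (h a) (norm_nonneg (g a))]

/-- The continuous linear map `f ↦ (x ↦ x ^ k * f⁽ⁿ⁾(x))` into bounded continuous functions. -/
noncomputable def powMulIteratedDerivCLM (k n : ℕ) :
    𝓢(ℝ, ℝ) →L[ℝ] BoundedContinuousFunction ℝ ℝ :=
  toBoundedContinuousFunctionCLM ℝ ℝ ℝ ∘L smulLeftCLM ℝ (fun x : ℝ => x ^ k) ∘L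
    (derivCLM ℝ ℝ) ^ n

lemma derivCLM_pow_apply (n : ℕ) (f : 𝓢(ℝ, ℝ)) (x : ℝ) :
    ((derivCLM ℝ ℝ) ^ n) f x = iteratedDeriv n f x := by
  induction n generalizing x with
  | zero => simp
  | succ n ih =>
    rw [pow_succ', mul_apply_eq_comp, derivCLM_apply, iteratedDeriv_succ]
    congr 1
    ext y
    exact ih y

lemma powMulIteratedDerivCLM_apply (k n : ℕ) (f : 𝓢(ℝ, ℝ)) (x : ℝ) :
    powMulIteratedDerivCLM k n f x = x ^ k * iteratedDeriv n f x := by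
  have : Function.HasTemperateGrowth (fun x : ℝ => x ^ k) := by fun_prop
  rw [powMulIteratedDerivCLM, ContinuousLinearMap.comp_apply, ContinuousLinearMap.comp_apply,
    toBoundedContinuousFunctionCLM_apply, smulLeftCLM_apply_apply this, derivCLM_pow_apply,
    smul_eq_mul]

lemma seminorm_le_norm_powMulIteratedDerivCLM (k n : ℕ) (f : 𝓢(ℝ, ℝ)) :
    SchwartzMap.seminorm ℝ k n f ≤ ‖powMulIteratedDerivCLM k n f‖ := by
  refine seminorm_le_bound' ℝ k n f (norm_nonneg _) fun x => ?_
  have := (powMulIteratedDerivCLM k n f).norm_coe_le_norm x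
  rwa [powMulIteratedDerivCLM_apply, norm_mul, norm_pow, Real.norm_eq_abs] at this

/-- A functional dominated by the norm of a linear map `T` factors through `T`. -/
lemma exists_eq_comp_of_norm_le {V E : Type*} [AddCommGroup V] [Module ℝ V] [TopologicalSpace V]
    [NormedAddCommGroup E] [NormedSpace ℝ E] (u : V →L[ℝ] ℝ) (T : V →L[ℝ] E) (C : ℝ)
    (hu : ∀ f, ‖u f‖ ≤ C * ‖T f‖) : ∃ L : StrongDual ℝ E, u = L ∘L T := by
  obtain ⟨h, hh⟩ := LinearMap.exists_rightInverse_of_surjective T.toLinearMap.rangeRestrict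
    T.toLinearMap.range_rangeRestrict
  have hTh : ∀ y : T.toLinearMap.range, T (h y) = y := fun y =>
    congrArg Subtype.val (LinearMap.congr_fun hh y)
  obtain ⟨L, hL, -⟩ := exists_extension_norm_eq T.toLinearMap.range
    ((u.toLinearMap ∘ₗ h).mkContinuous C fun y => by simpa [hTh] using hu (h y))
  refine ⟨L, ?_⟩
  ext f
  have h1 : L (T f) = u (h ⟨T f, LinearMap.mem_range_self T.toLinearMap f⟩) := by
    simpa using hL ⟨T f, LinearMap.mem_range_self T.toLinearMap f⟩
  have h2 := hu (f - h ⟨T f, LinearMap.mem_range_self T.toLinearMap f⟩)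
  rw [map_sub, map_sub, hTh, sub_self, norm_zero, mul_zero] at h2
  rw [ContinuousLinearMap.comp_apply, h1]
  exact sub_eq_zero.1 (norm_le_zero_iff.1 h2)

/-- Every tempered distribution factors through finitely many of the maps
`powMulIteratedDerivCLM`. -/
lemma exists_eq_comp_powMulIteratedDerivCLM (u : 𝓢(ℝ, ℝ) →L[ℝ] ℝ) :
    ∃ (s : Finset (ℕ × ℕ)) (L : StrongDual ℝ (s → BoundedContinuousFunction ℝ ℝ)),
      u = L ∘L ContinuousLinearMap.pi fun i : s => powMulIteratedDerivCLM i.1.1 i.1.2 := by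
  obtain ⟨s, C, -, hC⟩ := Seminorm.bound_of_continuous (schwartz_withSeminorms ℝ ℝ ℝ)
    ((normSeminorm ℝ ℝ).comp u.toLinearMap) (continuous_norm.comp u.continuous)
  set T : 𝓢(ℝ, ℝ) →L[ℝ] (s → BoundedContinuousFunction ℝ ℝ) :=
    ContinuousLinearMap.pi fun i : s => powMulIteratedDerivCLM i.1.1 i.1.2 with hT
  have hu : ∀ f, ‖u f‖ ≤ C * ‖T f‖ := fun f => by
    refine (hC f).trans ?_
    change (C : ℝ) * (s.sup (schwartzSeminormFamily ℝ ℝ ℝ)) f ≤ _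
    gcongr
    refine Seminorm.finset_sup_apply_le (norm_nonneg _) fun m hm => ?_
    exact (seminorm_le_norm_powMulIteratedDerivCLM m.1 m.2 f).trans (norm_le_pi_norm (T f) ⟨m, hm⟩)
  obtain ⟨L, hL⟩ := exists_eq_comp_of_norm_le u T C hu
  exact ⟨s, L, hL⟩

lemma integral_mul_iteratedDeriv_sub (n : ℕ) (f g : 𝓢(ℝ, ℝ)) (x : ℝ) :
    ∫ a, g a * iteratedDeriv n f (x - a) = ∫ a, f a * iteratedDeriv n g (x - a) := by
  have key : ∀ n (f g : 𝓢(ℝ, ℝ)), ∫ a, g a * iteratedDeriv n f (x - a) =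
      ∫ a, iteratedDeriv n g a * f (x - a) := by
    intro n
    induction n with
    | zero => intro f g; simp
    | succ n ih =>
      intro f g
      have h1 : ∀ y, iteratedDeriv (n + 1) f y = iteratedDeriv n (derivCLM ℝ ℝ f) y := fun y => by
        rw [iteratedDeriv_succ']; rfl
      have h2 : iteratedDeriv (n + 1) g = deriv ((derivCLM ℝ ℝ ^ n) g) := by
        rw [iteratedDeriv_succ]; congr 1; ext y; exact (derivCLM_pow_apply n g y).symm
      let r : 𝓢(ℝ, ℝ) :=
        (compCLMOfContinuousLinearEquiv ℝ (ContinuousLinearEquiv.neg ℝ) f).compSubConstCLM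
          ℝ x
      have hr : ∀ a, r a = f (x - a) := fun a => by simp [r]
      have hr' : ∀ a, deriv r a = - deriv f (x - a) := fun a => by
        rw [show (r : ℝ → ℝ) = fun a => f (x - a) from funext hr, deriv_comp_const_sub]
      have := integral_mul_deriv_eq_neg_deriv_mul ((derivCLM ℝ ℝ ^ n) g) r
      simp only [hr, hr', ← h2, derivCLM_pow_apply, mul_neg, integral_neg, neg_inj] at this
      rw [← this]
      simp_rw [h1, ih]
      rfl
  rw [key, ← integral_sub_left_eq_self _ volume x]
  simp only [sub_sub_cancel]
  simp_rw [mul_comm]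

/-- The identity `⟨u, f ⋆ g⟩ = ⟨u, g ⋆ f⟩`, with both convolutions taken outside the pairing. -/
lemma integral_smul_compSubConstCLM_comm (u : 𝓢(ℝ, ℝ) →L[ℝ] ℝ) (f g : 𝓢(ℝ, ℝ)) :
    ∫ a, g a * u (f.compSubConstCLM ℝ a) = ∫ a, f a * u (g.compSubConstCLM ℝ a) := by
  obtain ⟨s, L, rfl⟩ := exists_eq_comp_powMulIteratedDerivCLM u
  set T : 𝓢(ℝ, ℝ) →L[ℝ] (s → BoundedContinuousFunction ℝ ℝ) :=
    ContinuousLinearMap.pi fun i : s => powMulIteratedDerivCLM i.1.1 i.1.2 with hT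
  have hL : ∀ f g : 𝓢(ℝ, ℝ), ∫ a, g a * (L ∘L T) (f.compSubConstCLM ℝ a) =
      L (∫ a, g a • T (f.compSubConstCLM ℝ a)) := fun f g => by
    rw [← L.integral_comp_comm (integrable_smul_compSubConstCLM T f g)]
    simp
  have hE : ∀ (f g : 𝓢(ℝ, ℝ)) (i : s) (x : ℝ), (∫ a, g a • T (f.compSubConstCLM ℝ a)) i x =
      x ^ i.1.1 * ∫ a, g a * iteratedDeriv i.1.2 f (x - a) := fun f g i x => by
    have := (BoundedContinuousFunction.evalCLM ℝ x ∘L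
      (ContinuousLinearMap.proj i :
        (s → BoundedContinuousFunction ℝ ℝ) →L[ℝ] _)).integral_comp_comm
        (integrable_smul_compSubConstCLM T f g)
    refine Eq.trans this.symm ?_
    rw [← integral_const_mul]
    refine integral_congr_ae (.of_forall fun a => ?_)
    simp [hT, powMulIteratedDerivCLM_apply, iteratedDeriv_compSubConstCLM]
    ring
  rw [hL, hL]
  congr 1
  ext i x
  rw [hE, hE, integral_mul_iteratedDeriv_sub]

/-- The mollifier `x ↦ ε⁻¹ φ(ε⁻¹ x)`. -/
noncomputable def mollifier (φ : 𝓢(ℝ, ℝ)) (ε : ℝ) (hε : ε ≠ 0) : 𝓢(ℝ, ℝ) :=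
  ε⁻¹ • compCLMOfContinuousLinearEquiv ℝ
    (ContinuousLinearEquiv.unitsEquivAut ℝ (Units.mk0 ε⁻¹ (inv_ne_zero hε))) φ

lemma mollifier_apply (φ : 𝓢(ℝ, ℝ)) (ε : ℝ) (hε : ε ≠ 0) (x : ℝ) :
    mollifier φ ε hε x = ε⁻¹ * φ (ε⁻¹ * x) := by
  simp [mollifier, mul_comm]

/-- Mollifications of a tempered distribution converge to it. -/
lemma tendsto_integral_mul_mollifier (u : 𝓢(ℝ, ℝ) →L[ℝ] ℝ) (φ ψ : 𝓢(ℝ, ℝ))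
    (hφ : ∫ x, φ x = 1) (ε : ℕ → ℝ) (hε : ∀ n, 0 < ε n) (hε1 : ∀ n, ε n ≤ 1)
    (hε0 : Tendsto ε atTop (𝓝 0)) :
    Tendsto (fun n => ∫ a, ψ a * u ((mollifier φ (ε n) (hε n).ne').compSubConstCLM ℝ a))
      atTop (𝓝 (u ψ)) := by
  have h1 : ∀ n, ∫ a, ψ a * u ((mollifier φ (ε n) (hε n).ne').compSubConstCLM ℝ a) =
      ∫ z, φ z * u (ψ.compSubConstCLM ℝ (ε n * z)) := fun n => by
    rw [integral_smul_compSubConstCLM_comm]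
    have := Measure.integral_comp_mul_left
      (fun z => φ z * u (ψ.compSubConstCLM ℝ (ε n * z))) (ε n)⁻¹
    rw [inv_inv, abs_of_pos (hε n), smul_eq_mul] at this
    simp_rw [mollifier_apply, mul_assoc, integral_const_mul]
    rw [inv_mul_eq_iff_eq_mul₀ (hε n).ne', ← this]
    simp_rw [mul_inv_cancel_left₀ (hε n).ne']
  simp_rw [h1]
  have h2 : u ψ = ∫ z, φ z * u ψ := by rw [integral_mul_const, hφ, one_mul]
  rw [h2]
  obtain ⟨M, N, hM, h⟩ := exists_norm_compSubConstCLM_le u ψ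
  have hc : Continuous fun a : ℝ => u (ψ.compSubConstCLM ℝ a) :=
    u.continuous.comp ψ.continuous_compSubConstCLM
  refine tendsto_integral_of_dominated_convergence
    (fun z => M * (‖φ z‖ * (1 + |z|) ^ N)) (fun n => ?_)
    ((integrable_mul_one_add_abs_pow φ N).const_mul M) (fun n => .of_forall fun z => ?_)
    (.of_forall fun z => ?_)
  · exact (φ.continuous.mul (hc.comp (continuous_const.mul continuous_id))).aestronglyMeasurable
  · rw [norm_mul]
    have h3 : ‖u (ψ.compSubConstCLM ℝ (ε n * z))‖ ≤ M * (1 + |z|) ^ N := by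
      refine (h _).trans ?_
      have h4 : |ε n * z| ≤ |z| := by
        rw [abs_mul, abs_of_pos (hε n)]
        exact mul_le_of_le_one_left (abs_nonneg z) (hε1 n)
      gcongr
    nlinarith [mul_le_mul_of_nonneg_left h3 (norm_nonneg (φ z))]
  · have h4 : Tendsto (fun n => ε n * z) atTop (𝓝 0) := by simpa using hε0.mul_const z
    have h5 := (hc.tendsto 0).comp h4
    simp only [compSubConstCLM_zero, ContinuousLinearMap.id_apply] at h5
    exact h5.const_mul (φ z)

end SchwartzMap

lemma lintegral_enorm_le_of_lintegral_sq_le {Ω : Type*} {mΩ : MeasurableSpace Ω} {P : Measure Ω}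
    [IsProbabilityMeasure P] {f : Ω → ℝ} (hf : Measurable f) {c K : ℝ} (hc : 0 < c) (hK : 0 ≤ K)
    (h : ∫⁻ ω, ENNReal.ofReal (f ω ^ 2) ∂P ≤ ENNReal.ofReal K) :
    ∫⁻ ω, ‖f ω‖ₑ ∂P ≤ ENNReal.ofReal (c + c⁻¹ * K) := by
  have hpt : ∀ x : ℝ, |x| ≤ c + c⁻¹ * x ^ 2 := fun x => by
    have h1 : c * (c + c⁻¹ * x ^ 2 - |x|) = (c - |x| / 2) ^ 2 + 3 / 4 * |x| ^ 2 := by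
      rw [← sq_abs x]; field_simp; ring
    have h2 : 0 ≤ c * (c + c⁻¹ * x ^ 2 - |x|) := by rw [h1]; positivity
    linarith [nonneg_of_mul_nonneg_right h2 hc]
  calc ∫⁻ ω, ‖f ω‖ₑ ∂P
      ≤ ∫⁻ ω, (ENNReal.ofReal c + ENNReal.ofReal c⁻¹ * ENNReal.ofReal (f ω ^ 2)) ∂P := by
        refine lintegral_mono fun ω => ?_
        rw [← ENNReal.ofReal_mul (by positivity), ← ENNReal.ofReal_add hc.le (by positivity),
          Real.enorm_eq_ofReal_abs]
        exact ENNReal.ofReal_le_ofReal (hpt _)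
    _ = ENNReal.ofReal c + ENNReal.ofReal c⁻¹ * ∫⁻ ω, ENNReal.ofReal (f ω ^ 2) ∂P := by
        rw [lintegral_add_left measurable_const, lintegral_const, measure_univ, mul_one,
          lintegral_const_mul _ (by fun_prop)]
    _ ≤ ENNReal.ofReal c + ENNReal.ofReal c⁻¹ * ENNReal.ofReal K := by gcongr
    _ = ENNReal.ofReal (c + c⁻¹ * K) := by
        rw [← ENNReal.ofReal_mul (by positivity), ← ENNReal.ofReal_add hc.le (by positivity)]

lemma SchwartzMap.integrable_mul_max_one_abs_rpow (ψ : 𝓢(ℝ, ℝ)) {δ : ℝ} (hδ0 : 0 < δ)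
    (hδ1 : δ < 1) : Integrable fun a : ℝ => ‖ψ a‖ * max 1 (|a| ^ (δ - 1)) := by
  have hmeas : Measurable fun a : ℝ => |a| ^ (δ - 1) := by fun_prop
  have hloc : IntegrableOn (fun a : ℝ => |a| ^ (δ - 1)) (Set.Icc (-1) 1) :=
    (locallyIntegrable_of_norm_le_rpow (E := ℝ) (f := fun a : ℝ => |a| ^ (δ - 1)) (C := 1)
      (α := 1 - δ) (by simp) (by simp; linarith) (.of_forall fun a => by
        rw [neg_sub, one_mul, Real.norm_of_nonneg (by positivity), Real.norm_eq_abs])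
      hmeas.aestronglyMeasurable).integrableOn_isCompact isCompact_Icc
  refine (ψ.integrable.norm.add (((integrable_indicator_iff measurableSet_Icc).2 hloc).const_mul
    (SchwartzMap.seminorm ℝ 0 0 ψ))).mono'
    (ψ.continuous.norm.measurable.mul (measurable_const.max hmeas)).aestronglyMeasurable
    (.of_forall fun a => ?_)
  have hpos : 0 ≤ |a| ^ (δ - 1) := by positivity
  rw [Real.norm_of_nonneg (by positivity), Pi.add_apply]
  by_cases ha : a ∈ Set.Icc (-1 : ℝ) 1
  · rw [Set.indicator_of_mem ha]
    have hmax : max 1 (|a| ^ (δ - 1)) ≤ 1 + |a| ^ (δ - 1) := by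
      rw [max_le_iff]; constructor <;> linarith
    nlinarith [mul_le_mul_of_nonneg_left hmax (norm_nonneg (ψ a)),
      mul_le_mul_of_nonneg_right (norm_le_seminorm ℝ ψ a) hpos]
  · rw [Set.indicator_of_notMem ha, mul_zero, add_zero]
    have h1 : 1 ≤ |a| := by
      by_contra! h
      exact ha (abs_le.1 h.le)
    rw [max_eq_left (Real.rpow_le_one_of_one_le_of_nonpos h1 (by linarith)), mul_one]

/-- A random tempered distribution whose pairings with the mollifiers
`φ_ε^a(x) = ε⁻¹ φ(ε⁻¹(x - a))` have second moments bounded by `C max(1, |a|^{δ-1})` and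
vanishing as `ε → 0` for every `a ≠ 0` must vanish: `⟨w, ψ⟩ = 0` a.s. for every Schwartz `ψ`. -/
theorem random_distribution_vanishes_of_mollified_second_moments
    {Ω : Type*} {mΩ : MeasurableSpace Ω} (P : Measure Ω) [IsProbabilityMeasure P]
    (w : Ω → (SchwartzMap ℝ ℝ →L[ℝ] ℝ))
    (hmeas : ∀ ψ : SchwartzMap ℝ ℝ, Measurable fun ω => w ω ψ)
    (φ : SchwartzMap ℝ ℝ) (hφeven : ∀ x : ℝ, φ (-x) = φ x)
    (hφint : (∫ x : ℝ, φ x) = 1)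
    (δ C : ℝ) (hδ0 : 0 < δ) (hδ1 : δ < 1) (hC : 0 ≤ C)
    (hbound : ∀ a : ℝ, a ≠ 0 → ∀ ε : ℝ, 0 < ε → ε ≤ 1 →
      ∀ ψ : SchwartzMap ℝ ℝ, (∀ x : ℝ, ψ x = ε⁻¹ * φ (ε⁻¹ * (x - a))) →
      ∫⁻ ω, ENNReal.ofReal ((w ω ψ) ^ 2) ∂P ≤
        ENNReal.ofReal (C * max 1 (|a| ^ (δ - 1))))
    (hlim : ∀ a : ℝ, a ≠ 0 → ∀ c : ℝ, 0 < c → ∃ ε₀ : ℝ, 0 < ε₀ ∧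
      ∀ ε : ℝ, 0 < ε → ε < ε₀ →
      ∀ ψ : SchwartzMap ℝ ℝ, (∀ x : ℝ, ψ x = ε⁻¹ * φ (ε⁻¹ * (x - a))) →
      ∫⁻ ω, ENNReal.ofReal ((w ω ψ) ^ 2) ∂P ≤ ENNReal.ofReal c) :
    ∀ ψ : SchwartzMap ℝ ℝ, ∀ᵐ ω ∂P, w ω ψ = 0 := by
  intro ψ
  let ε : ℕ → ℝ := fun n => 1 / ((n : ℝ) + 1)
  have hε : ∀ n, 0 < ε n := fun n => by positivity
  have hε1 : ∀ n, ε n ≤ 1 := fun n => by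
    rw [div_le_one (by positivity)]; simp
  have hε0 : Tendsto ε atTop (𝓝 0) := tendsto_one_div_add_atTop_nhds_zero_nat
  let Φ : ℕ → ℝ → 𝓢(ℝ, ℝ) := fun n a => (mollifier φ (ε n) (hε n).ne').compSubConstCLM ℝ a
  have hΦ : ∀ n a x, Φ n a x = (ε n)⁻¹ * φ ((ε n)⁻¹ * (x - a)) := fun n a x =>
    mollifier_apply φ (ε n) (hε n).ne' (x - a)
  have hX : ∀ n, Measurable (Function.uncurry fun (a : ℝ) ω => w ω (Φ n a)) := fun n =>
    measurable_uncurry_of_continuous_of_measurable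
      (fun ω => (w ω).continuous.comp (continuous_compSubConstCLM _)) fun a => hmeas _
  let A : ℕ → ℝ → ENNReal := fun n a => ∫⁻ ω, ‖w ω (Φ n a)‖ₑ ∂P
  have hA : ∀ n, Measurable (A n) := fun n => (hX n).enorm.lintegral_prod_right'
  have hA_bound : ∀ n a, a ≠ 0 →
      A n a ≤ ENNReal.ofReal (1 + 1⁻¹ * (C * max 1 (|a| ^ (δ - 1)))) := fun n a ha =>
    lintegral_enorm_le_of_lintegral_sq_le (hmeas _) one_pos (by positivity)
      (hbound a ha (ε n) (hε n) (hε1 n) _ (hΦ n a))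
  have hA_lim : ∀ a, a ≠ 0 → Tendsto (fun n => A n a) atTop (𝓝 0) := fun a ha => by
    rw [ENNReal.tendsto_nhds_zero]
    intro e he
    obtain ⟨r, hr0, hre⟩ := ENNReal.lt_iff_exists_nnreal_btwn.1 he
    have hr : (0 : ℝ) < r := by exact_mod_cast hr0
    obtain ⟨ε₀, hε₀, h⟩ := hlim a ha (r / 2 * (r / 2)) (by positivity)
    filter_upwards [hε0.eventually_lt_const hε₀] with n hn
    refine (lintegral_enorm_le_of_lintegral_sq_le (hmeas _) (half_pos hr) (by positivity)
      (h (ε n) (hε n) hn _ (hΦ n a))).trans ?_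
    rw [inv_mul_cancel_left₀ (half_pos hr).ne', add_halves, ENNReal.ofReal_coe_nnreal]
    exact hre.le
  have hne : ∀ᵐ a : ℝ, a ≠ 0 := Measure.ae_ne volume 0
  have hdom : ∫⁻ a, ‖ψ a‖ₑ * ENNReal.ofReal (1 + 1⁻¹ * (C * max 1 (|a| ^ (δ - 1)))) ≠ ⊤ := by
    have hint := ψ.integrable.norm.add
      ((ψ.integrable_mul_max_one_abs_rpow hδ0 hδ1).const_mul C)
    refine ((lintegral_mono fun a => ?_).trans_lt hint.2).ne
    rw [← ofReal_norm, ← ENNReal.ofReal_mul (norm_nonneg _), Real.enorm_eq_ofReal_abs]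
    refine ENNReal.ofReal_le_ofReal ((le_of_eq ?_).trans (le_abs_self _))
    simp only [Pi.add_apply]
    ring
  have hlim0 : Tendsto (fun n => ∫⁻ a, ‖ψ a‖ₑ * A n a) atTop (𝓝 0) := by
    have := tendsto_lintegral_filter_of_dominated_convergence (μ := volume) (l := atTop)
      (F := fun n a => ‖ψ a‖ₑ * A n a) (f := fun _ => 0) _
      (.of_forall fun n => ψ.continuous.measurable.enorm.mul (hA n))
      (.of_forall fun n => by
        filter_upwards [hne] with a ha
        exact mul_le_mul_right (hA_bound n a ha) ‖ψ a‖ₑ) hdom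
      (by
        filter_upwards [hne] with a ha
        simpa using ENNReal.Tendsto.const_mul (hA_lim a ha) (Or.inr enorm_ne_top))
    simpa using this
  let Y : ℕ → Ω → ℝ := fun n ω => ∫ a, ψ a * w ω (Φ n a)
  have hZ : ∀ n, Measurable (Function.uncurry fun (a : ℝ) ω => ψ a * w ω (Φ n a)) := fun n =>
    (ψ.continuous.measurable.comp measurable_fst).mul (hX n)
  have hY : ∀ n, Measurable (Y n) := fun n =>
    (StronglyMeasurable.integral_prod_left (hZ n).stronglyMeasurable).measurable
  have hY_lim : ∀ ω, Tendsto (fun n => ‖Y n ω‖ₑ) atTop (𝓝 ‖w ω ψ‖ₑ) := fun ω =>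
    (tendsto_integral_mul_mollifier (w ω) φ ψ hφint ε hε hε1 hε0).enorm
  have hY_le : ∀ n, ∫⁻ ω, ‖Y n ω‖ₑ ∂P ≤ ∫⁻ a, ‖ψ a‖ₑ * A n a := fun n => by
    calc ∫⁻ ω, ‖Y n ω‖ₑ ∂P
        ≤ ∫⁻ ω, (∫⁻ a, ‖ψ a * w ω (Φ n a)‖ₑ) ∂P :=
          lintegral_mono fun ω => enorm_integral_le_lintegral_enorm _
      _ = ∫⁻ a, ∫⁻ ω, ‖ψ a * w ω (Φ n a)‖ₑ ∂P :=
          (lintegral_lintegral_swap (μ := volume) (ν := P)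
            (f := fun a ω => ‖ψ a * w ω (Φ n a)‖ₑ) (hZ n).enorm.aemeasurable).symm
      _ = ∫⁻ a, ‖ψ a‖ₑ * A n a := by
          simp_rw [enorm_mul]
          exact lintegral_congr fun a => lintegral_const_mul _ (hmeas _).enorm
  have hzero : ∫⁻ ω, ‖w ω ψ‖ₑ ∂P = 0 := by
    refine le_antisymm ?_ zero_le
    calc ∫⁻ ω, ‖w ω ψ‖ₑ ∂P
        = ∫⁻ ω, liminf (fun n => ‖Y n ω‖ₑ) atTop ∂P :=
          lintegral_congr fun ω => (hY_lim ω).liminf_eq.symm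
      _ ≤ liminf (fun n => ∫⁻ ω, ‖Y n ω‖ₑ ∂P) atTop :=
          lintegral_liminf_le fun n => (hY n).enorm
      _ ≤ liminf (fun n => ∫⁻ a, ‖ψ a‖ₑ * A n a) atTop :=
          liminf_le_liminf (.of_forall hY_le)
      _ = 0 := hlim0.liminf_eq
  filter_upwards [(lintegral_eq_zero_iff (hmeas ψ).enorm).1 hzero] with ω hω
  exact enorm_eq_zero.1 hω
end

section
/- Let μ be a finite nonnegative Borel measure on ℝ such that ∫ e^{η|y|} μ(dy) < ∞ for some η > 0. Then there is a continuous linear operator T on the Schwartz space 𝒮(ℝ) such that (Tφ)(x) = ∫ φ(x − y) μ(dy) for every φ ∈ 𝒮(ℝ) and every x ∈ ℝ; that is, convolution with μ maps the Schwartz space continuously into itself. -/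
open MeasureTheory

open scoped SchwartzMap ContDiff

lemma integrable_abs_pow_of_lintegral_exp_mul_abs_ne_top {μ : Measure ℝ} {η : ℝ} (hη : 0 < η)
    (hexp : ∫⁻ y, ENNReal.ofReal (Real.exp (η * |y|)) ∂μ ≠ ⊤) (k : ℕ) :
    Integrable (fun y : ℝ ↦ |y| ^ k) μ := by
  have hint : Integrable (fun y : ℝ ↦ Real.exp (η * |y|)) μ :=
    (lintegral_ofReal_ne_top_iff_integrable (by fun_prop)
      (ae_of_all _ fun _ ↦ (Real.exp_pos _).le)).1 hexp
  refine (hint.const_mul (k.factorial / η ^ k)).mono' (by fun_prop) (ae_of_all _ fun y ↦ ?_)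
  have h := Real.pow_div_factorial_le_exp (η * |y|) (by positivity) k
  rw [Real.norm_of_nonneg (by positivity), div_mul_eq_mul_div, le_div_iff₀ (by positivity)]
  rw [div_le_iff₀ (by positivity), mul_pow] at h
  linarith

namespace SchwartzMap

lemma integrable_comp_sub (μ : Measure ℝ) [IsFiniteMeasure μ] (φ : 𝓢(ℝ, ℝ)) (x : ℝ) :
    Integrable (fun y ↦ φ (x - y)) μ :=
  .of_bound (φ.continuous.comp (by fun_prop)).aestronglyMeasurable (SchwartzMap.seminorm ℝ 0 0 φ)
    (ae_of_all _ fun _ ↦ φ.norm_le_seminorm ℝ _)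

lemma hasDerivAt_integral_comp_sub (μ : Measure ℝ) [IsFiniteMeasure μ] (φ : 𝓢(ℝ, ℝ)) (x : ℝ) :
    HasDerivAt (fun x ↦ ∫ y, φ (x - y) ∂μ) (∫ y, derivCLM ℝ ℝ φ (x - y) ∂μ) x :=
  (hasDerivAt_integral_of_dominated_loc_of_deriv_le (s := Set.univ)
    (F' := fun x y ↦ derivCLM ℝ ℝ φ (x - y))
    (bound := fun _ ↦ SchwartzMap.seminorm ℝ 0 0 (derivCLM ℝ ℝ φ)) Filter.univ_mem
    (.of_forall fun x ↦ (φ.integrable_comp_sub μ x).aestronglyMeasurable)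
    (φ.integrable_comp_sub μ x)
    ((derivCLM ℝ ℝ φ).integrable_comp_sub μ x).aestronglyMeasurable
    (ae_of_all _ fun _ _ _ ↦ norm_le_seminorm ℝ _ _)
    (integrable_const _)
    (ae_of_all _ fun y x _ ↦ (φ.differentiableAt (x := x - y)).hasDerivAt.comp_sub_const x y)).2

lemma deriv_integral_comp_sub (μ : Measure ℝ) [IsFiniteMeasure μ] (φ : 𝓢(ℝ, ℝ)) :
    deriv (fun x ↦ ∫ y, φ (x - y) ∂μ) = fun x ↦ ∫ y, derivCLM ℝ ℝ φ (x - y) ∂μ :=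
  funext fun x ↦ (φ.hasDerivAt_integral_comp_sub μ x).deriv

lemma contDiff_integral_comp_sub (μ : Measure ℝ) [IsFiniteMeasure μ] (φ : 𝓢(ℝ, ℝ)) :
    ContDiff ℝ ∞ (fun x ↦ ∫ y, φ (x - y) ∂μ) := by
  refine contDiff_infty.2 fun n ↦ ?_
  induction n generalizing φ with
  | zero =>
    exact contDiff_zero.2 (continuous_iff_continuousAt.2
      fun x ↦ (φ.hasDerivAt_integral_comp_sub μ x).continuousAt)
  | succ n ih =>
    push_cast
    refine contDiff_succ_iff_deriv.2
      ⟨fun x ↦ (φ.hasDerivAt_integral_comp_sub μ x).differentiableAt, by simp, ?_⟩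
    rw [deriv_integral_comp_sub]
    exact ih _

lemma iteratedDeriv_integral_comp_sub (μ : Measure ℝ) [IsFiniteMeasure μ] (φ : 𝓢(ℝ, ℝ)) (n : ℕ) :
    iteratedDeriv n (fun x ↦ ∫ y, φ (x - y) ∂μ) = fun x ↦ ∫ y, iteratedDeriv n φ (x - y) ∂μ := by
  induction n generalizing φ with
  | zero => simp
  | succ n ih =>
    rw [iteratedDeriv_succ', deriv_integral_comp_sub, ih, iteratedDeriv_succ']
    rfl

lemma abs_pow_mul_norm_iteratedDeriv_integral_comp_sub_le
    {μ : Measure ℝ} [IsFiniteMeasure μ] (hμ : ∀ k : ℕ, Integrable (fun y : ℝ ↦ |y| ^ k) μ)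
    (φ : 𝓢(ℝ, ℝ)) (k n : ℕ) (x : ℝ) :
    |x| ^ k * ‖iteratedDeriv n (fun x ↦ ∫ y, φ (x - y) ∂μ) x‖ ≤
      2 ^ (k - 1) * (μ.real Set.univ * SchwartzMap.seminorm ℝ k n φ +
        (∫ y, |y| ^ k ∂μ) * SchwartzMap.seminorm ℝ 0 n φ) := by
  rw [iteratedDeriv_integral_comp_sub]
  have hpt (y : ℝ) : ‖|x| ^ k * iteratedDeriv n φ (x - y)‖ ≤
      2 ^ (k - 1) * (SchwartzMap.seminorm ℝ k n φ + |y| ^ k * SchwartzMap.seminorm ℝ 0 n φ) := by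
    have hx : |x| ^ k ≤ 2 ^ (k - 1) * (|x - y| ^ k + |y| ^ k) :=
      (pow_le_pow_left₀ (abs_nonneg x) (by simpa using abs_add_le (x - y) y) k).trans
        (add_pow_le (abs_nonneg _) (abs_nonneg _) k)
    have h₀ : ‖iteratedDeriv n φ (x - y)‖ ≤ SchwartzMap.seminorm ℝ 0 n φ := by
      simpa using φ.le_seminorm' ℝ 0 n (x - y)
    calc ‖|x| ^ k * iteratedDeriv n φ (x - y)‖
        = |x| ^ k * ‖iteratedDeriv n φ (x - y)‖ := by
          rw [norm_mul, Real.norm_of_nonneg (by positivity)]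
      _ ≤ 2 ^ (k - 1) * (|x - y| ^ k + |y| ^ k) * ‖iteratedDeriv n φ (x - y)‖ := by gcongr
      _ = 2 ^ (k - 1) * (|x - y| ^ k * ‖iteratedDeriv n φ (x - y)‖ +
            |y| ^ k * ‖iteratedDeriv n φ (x - y)‖) := by ring
      _ ≤ _ := by
        gcongr
        exact φ.le_seminorm' ℝ k n (x - y)
  have hint : Integrable (fun y ↦ |y| ^ k * SchwartzMap.seminorm ℝ 0 n φ) μ :=
    (hμ k).mul_const _
  calc |x| ^ k * ‖∫ y, iteratedDeriv n φ (x - y) ∂μ‖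
      = ‖∫ y, |x| ^ k * iteratedDeriv n φ (x - y) ∂μ‖ := by
        rw [integral_const_mul, norm_mul, Real.norm_of_nonneg (by positivity : 0 ≤ |x| ^ k)]
    _ ≤ ∫ y, 2 ^ (k - 1) * (SchwartzMap.seminorm ℝ k n φ +
          |y| ^ k * SchwartzMap.seminorm ℝ 0 n φ) ∂μ :=
        norm_integral_le_of_norm_le (((integrable_const _).add hint).const_mul _)
          (ae_of_all _ hpt)
    _ = _ := by
        rw [integral_const_mul, integral_add (integrable_const _) hint, integral_const,
          integral_mul_const, smul_eq_mul]

end SchwartzMap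

/-- Convolution with a finite nonnegative Borel measure on `ℝ` possessing an exponential
moment is a continuous linear operator from the Schwartz space to itself. -/
theorem convolution_with_exponential_moment_measure_continuous_on_schwartz
    (μ : Measure ℝ) [IsFiniteMeasure μ] (η : ℝ) (hη : 0 < η)
    (hexp : ∫⁻ y, ENNReal.ofReal (Real.exp (η * |y|)) ∂μ ≠ ⊤) :
    ∃ T : SchwartzMap ℝ ℝ →L[ℝ] SchwartzMap ℝ ℝ,
      ∀ (φ : SchwartzMap ℝ ℝ) (x : ℝ), T φ x = ∫ y, φ (x - y) ∂μ := by
  refine ⟨SchwartzMap.mkCLM (fun φ x ↦ ∫ y, φ (x - y) ∂μ) (fun φ ψ x ↦ ?_) (fun a φ x ↦ ?_)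
    (fun φ ↦ φ.contDiff_integral_comp_sub μ) ?_, fun _ _ ↦ rfl⟩
  · exact integral_add (φ.integrable_comp_sub μ x) (ψ.integrable_comp_sub μ x)
  · exact integral_const_mul a _
  · rintro ⟨k, n⟩
    refine ⟨{(k, n), (0, n)}, 2 ^ (k - 1) * (μ.real Set.univ + ∫ y, |y| ^ k ∂μ),
      by positivity, fun φ x ↦ ?_⟩
    have hle {p : ℕ × ℕ} (hp : p ∈ ({(k, n), (0, n)} : Finset (ℕ × ℕ))) :
        SchwartzMap.seminorm ℝ p.1 p.2 φ ≤
          (({(k, n), (0, n)} : Finset (ℕ × ℕ)).sup (schwartzSeminormFamily ℝ ℝ ℝ)) φ :=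
      Finset.le_sup (f := schwartzSeminormFamily ℝ ℝ ℝ) hp φ
    have hk := hle (p := (k, n)) (by simp)
    have h₀ := hle (p := (0, n)) (by simp)
    rw [norm_iteratedFDeriv_eq_norm_iteratedDeriv, Real.norm_eq_abs, mul_assoc, add_mul]
    refine (φ.abs_pow_mul_norm_iteratedDeriv_integral_comp_sub_le
      (integrable_abs_pow_of_lintegral_exp_mul_abs_ne_top hη hexp) k n x).trans ?_
    gcongr
end

section
/- Let (Ω, 𝔉, P) be a probability space, k ≥ 2 an integer, and let 𝒢₁, …, 𝒢_k be sub-σ-algebras of 𝔉. Let ε ≥ 0 be such that for each 1 ≤ i ≤ k − 1 and all events A ∈ σ(𝒢₁ ∪ ⋯ ∪ 𝒢_i) and B ∈ 𝒢_{i+1}, |P(A ∩ B) − P(A)P(B)| ≤ ε. Then for any real random variables f₁, …, f_k with f_i measurable with respect to 𝒢_i and |f_i| ≤ 1 almost surely, | E[ Π_{i=1}^k f_i ] − Π_{i=1}^k E[f_i] | ≤ 4(k − 1)ε. -/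
open MeasureTheory

/-- Integrating a centered function against an `m`-measurable `[-1,1]`-valued weight is controlled
by its integral over a single `m`-measurable set. -/
theorem exists_measurableSet_abs_integral_mul_le {Ω : Type*} {m m0 : MeasurableSpace Ω}
    {P : Measure Ω} [IsFiniteMeasure P] (hm : m ≤ m0) {X W : Ω → ℝ}
    (hX : Measurable[m] X) (hX1 : ∀ᵐ ω ∂P, |X ω| ≤ 1)
    (hW : Integrable W P) (hW0 : ∫ ω, W ω ∂P = 0) :
    ∃ A, MeasurableSet[m] A ∧ |∫ ω, X ω * W ω ∂P| ≤ 2 * ∫ ω in A, W ω ∂P := by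
  set g := P[W|m] with hg
  have hgm : StronglyMeasurable[m] g := stronglyMeasurable_condExp
  have hgi : Integrable g P := integrable_condExp
  have hA : MeasurableSet[m] {ω | 0 ≤ g ω} :=
    hgm.measurable measurableSet_Ici
  refine ⟨{ω | 0 ≤ g ω}, hA, ?_⟩
  have hXW : Integrable (X * W) P :=
    hW.bdd_mul (hX.mono hm le_rfl).aestronglyMeasurable hX1
  have hXg : ∫ ω, X ω * W ω ∂P = ∫ ω, X ω * g ω ∂P := by
    rw [← integral_condExp (f := fun ω => X ω * W ω) hm]
    exact integral_congr_ae
      (condExp_mul_of_stronglyMeasurable_left hX.stronglyMeasurable hXW hW)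
  have hg0 : ∫ ω, g ω ∂P = 0 := by rw [hg, integral_condExp hm, hW0]
  calc |∫ ω, X ω * W ω ∂P| ≤ ∫ ω, |g ω| ∂P := by
        rw [hXg, ← Real.norm_eq_abs]
        refine norm_integral_le_of_norm_le hgi.abs ?_
        filter_upwards [hX1] with ω h
        rw [Real.norm_eq_abs, abs_mul]
        exact mul_le_of_le_one_left (abs_nonneg _) h
    _ = ∫ ω, (2 * {ω | 0 ≤ g ω}.indicator g ω - g ω) ∂P := by
        refine integral_congr_ae (.of_forall fun ω => ?_)
        by_cases h : 0 ≤ g ω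
        · simp [Set.indicator, h, abs_of_nonneg h, two_mul]
        · simp [Set.indicator, h, abs_of_neg (not_le.mp h)]
    _ = 2 * ∫ ω in {ω | 0 ≤ g ω}, W ω ∂P := by
        rw [integral_sub ((hgi.indicator (hm _ hA)).const_mul 2) hgi, hg0, sub_zero,
          integral_const_mul, integral_indicator (hm _ hA), setIntegral_condExp hm hW hA]

/-- **Covariance inequality for α-mixing σ-algebras.** -/
theorem abs_integral_mul_sub_le_of_alpha_mixing {Ω : Type*} {m₁ m₂ m0 : MeasurableSpace Ω}
    {P : Measure Ω} [IsProbabilityMeasure P] (hm₁ : m₁ ≤ m0) (hm₂ : m₂ ≤ m0) {ε : ℝ}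
    (hmix : ∀ A B : Set Ω, MeasurableSet[m₁] A → MeasurableSet[m₂] B →
      |P.real (A ∩ B) - P.real A * P.real B| ≤ ε) {X Y : Ω → ℝ}
    (hX : Measurable[m₁] X) (hX1 : ∀ᵐ ω ∂P, |X ω| ≤ 1)
    (hY : Measurable[m₂] Y) (hY1 : ∀ᵐ ω ∂P, |Y ω| ≤ 1) :
    |(∫ ω, X ω * Y ω ∂P) - (∫ ω, X ω ∂P) * ∫ ω, Y ω ∂P| ≤ 4 * ε := by
  have hXi : Integrable X P :=
    .of_bound (hX.mono hm₁ le_rfl).aestronglyMeasurable 1 hX1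
  have hYi : Integrable Y P :=
    .of_bound (hY.mono hm₂ le_rfl).aestronglyMeasurable 1 hY1
  have hXY : Integrable (fun ω => X ω * Y ω) P :=
    hYi.bdd_mul (hX.mono hm₁ le_rfl).aestronglyMeasurable hX1
  set y := ∫ ω, Y ω ∂P with hy
  obtain ⟨A, hA, hAle⟩ := exists_measurableSet_abs_integral_mul_le hm₁ hX hX1
    (hYi.sub (integrable_const y)) (by
      simp only [Pi.sub_apply]
      rw [integral_sub hYi (integrable_const y)]
      simp [hy])
  have h1A : Integrable (A.indicator (1 : Ω → ℝ)) P := (integrable_const 1).indicator (hm₁ _ hA)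
  obtain ⟨B, hB, hBle⟩ := exists_measurableSet_abs_integral_mul_le hm₂ hY hY1
    (h1A.sub (integrable_const (P.real A)))
    (by simp [integral_sub h1A (integrable_const _), integral_indicator_one (hm₁ _ hA)])
  simp only [Pi.sub_apply, mul_sub] at hAle hBle
  have hYA : ∀ ω, Y ω * A.indicator (1 : Ω → ℝ) ω = A.indicator Y ω := fun ω => by
    by_cases h : ω ∈ A <;> simp [h]
  simp only [hYA] at hBle
  rw [integral_sub hXY (hXi.mul_const y), integral_mul_const,
    integral_sub hYi.integrableOn (integrable_const y).integrableOn, setIntegral_const,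
    smul_eq_mul] at hAle
  rw [integral_sub (hYi.indicator (hm₁ _ hA)) (hYi.mul_const _), integral_mul_const,
    integral_indicator (hm₁ _ hA),
    integral_sub h1A.integrableOn (integrable_const _).integrableOn, setIntegral_const,
    smul_eq_mul, integral_indicator_one (hm₁ _ hA),
    measureReal_restrict_apply (hm₁ _ hA), ← hy] at hBle
  have h1 := (le_abs_self _).trans (hmix A B hA hB)
  have h2 := (le_abs_self _).trans hBle
  linarith

theorem ae_abs_prod_le_one {Ω ι : Type*} [Fintype ι] {m0 : MeasurableSpace Ω} {P : Measure Ω}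
    {f : ι → Ω → ℝ} (hf : ∀ i, ∀ᵐ ω ∂P, |f i ω| ≤ 1) : ∀ᵐ ω ∂P, |∏ i, f i ω| ≤ 1 := by
  filter_upwards [ae_all_iff.mpr hf] with ω h
  rw [Finset.abs_prod]
  exact Finset.prod_le_one (fun _ _ => abs_nonneg _) fun i _ => h i

/-- Near-factorization of the expectation of a product, indexed by `Fin (n + 1)`. -/
theorem abs_integral_prod_sub_prod_integral_le {Ω : Type*} {m0 : MeasurableSpace Ω}
    (P : Measure Ω) [IsProbabilityMeasure P] {ε : ℝ} (n : ℕ) (𝒢 : Fin (n + 1) → MeasurableSpace Ω)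
    (h𝒢 : ∀ i, 𝒢 i ≤ m0)
    (hmix : ∀ (i : Fin n) (A B : Set Ω), MeasurableSet[⨆ j, ⨆ (_ : j ≤ i.castSucc), 𝒢 j] A →
      MeasurableSet[𝒢 i.succ] B → |P.real (A ∩ B) - P.real A * P.real B| ≤ ε)
    (f : Fin (n + 1) → Ω → ℝ) (hf : ∀ i, Measurable[𝒢 i] (f i))
    (hf1 : ∀ i, ∀ᵐ ω ∂P, |f i ω| ≤ 1) :
    |(∫ ω, ∏ i, f i ω ∂P) - ∏ i, ∫ ω, f i ω ∂P| ≤ 4 * n * ε := by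
  induction n with
  | zero => simp
  | succ n ih =>
    have hrec := ih (fun i => 𝒢 i.castSucc) (fun i => h𝒢 _)
      (fun i A B hA hB => hmix i.castSucc A B
        ((iSup₂_le fun j hj => le_iSup₂_of_le j.castSucc (by simpa using hj) le_rfl :
          (⨆ j : Fin (n + 1), ⨆ (_ : j ≤ i.castSucc), 𝒢 j.castSucc) ≤ _) A hA) hB)
      (fun i => f i.castSucc) (fun i => hf _) (fun i => hf1 _)
    have hU : Measurable[⨆ j, ⨆ (_ : j ≤ (Fin.last n).castSucc), 𝒢 j]
        fun ω => ∏ i : Fin (n + 1), f i.castSucc ω :=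
      Finset.measurable_fun_prod _ fun i _ => (hf i.castSucc).mono
        (le_iSup₂_of_le i.castSucc (by simpa using Fin.le_last i) le_rfl) le_rfl
    have hcov := abs_integral_mul_sub_le_of_alpha_mixing (iSup₂_le fun j _ => h𝒢 j) (h𝒢 _)
      (hmix (Fin.last n)) hU (ae_abs_prod_le_one fun i => hf1 _) (hf _) (hf1 _)
    have hlast : |∫ ω, f (Fin.last n).succ ω ∂P| ≤ 1 := by
      simpa using norm_integral_le_of_norm_le_const (μ := P) (f := f (Fin.last n).succ) (C := 1)
        (hf1 (Fin.last n).succ)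
    simp only [Fin.prod_univ_castSucc (n := n + 1), ← Fin.succ_last]
    set u := ∫ ω, ∏ i : Fin (n + 1), f i.castSucc ω ∂P
    set p := ∏ i : Fin (n + 1), ∫ ω, f i.castSucc ω ∂P
    set y := ∫ ω, f (Fin.last n).succ ω ∂P
    calc _ ≤ _ := abs_sub_le _ (u * y) _
      _ ≤ 4 * ε + 4 * n * ε := by
        refine add_le_add hcov ?_
        rw [← sub_mul, abs_mul]
        exact (mul_le_of_le_one_right (abs_nonneg _) hlast).trans hrec
      _ = _ := by push_cast; ring

/-- Products of `[-1,1]`-valued random variables measurable with respect to consecutively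
α-mixing σ-algebras nearly factorize: if consecutive blocks have mixing coefficient at most
`ε`, then `|E[Π f_i] - Π E[f_i]| ≤ 4(k-1)ε`. -/
theorem alpha_mixing_product_factorization
    {Ω : Type*} {m0 : MeasurableSpace Ω} (P : Measure Ω) [IsProbabilityMeasure P]
    (k : ℕ) (hk : 2 ≤ k) (𝒢 : Fin k → MeasurableSpace Ω) (h𝒢 : ∀ i, 𝒢 i ≤ m0)
    (ε : ℝ) (hε : 0 ≤ ε)
    (hmix : ∀ (i : Fin k) (hi : (i : ℕ) + 1 < k) (A B : Set Ω),
      MeasurableSet[⨆ j, ⨆ (_ : j ≤ i), 𝒢 j] A →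
      MeasurableSet[𝒢 ⟨(i : ℕ) + 1, hi⟩] B →
      |(P (A ∩ B)).toReal - (P A).toReal * (P B).toReal| ≤ ε)
    (f : Fin k → Ω → ℝ)
    (hfmeas : ∀ i, Measurable[𝒢 i] (f i))
    (hfbd : ∀ i, ∀ᵐ ω ∂P, |f i ω| ≤ 1) :
    |(∫ ω, ∏ i, f i ω ∂P) - ∏ i, ∫ ω, f i ω ∂P| ≤ 4 * ((k : ℝ) - 1) * ε := by
  obtain ⟨n, rfl⟩ : ∃ n, k = n + 1 := ⟨k - 1, by omega⟩
  simpa using abs_integral_prod_sub_prod_integral_le P n 𝒢 h𝒢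
    (fun i => hmix i.castSucc (by simp)) f hfmeas hfbd
end

section
/- Let k ≥ 1 and m ≥ 0 be integers and let η > 0, M ≥ 1. There is a constant C, depending only on k, m, η and M, such that for any two Borel probability measures ν and ν' on ℝ^k satisfying ∫ exp(η Σ_{j=1}^k |y_j|) ν(dy) ≤ M and ∫ exp(η Σ_{j=1}^k |y_j|) ν'(dy) ≤ M, and any multi-index r = (r₁, …, r_k) of nonnegative integers with r₁ + ⋯ + r_k ≤ m, one has | ∫ Π_{j=1}^k y_j^{r_j} ν(dy) − ∫ Π_{j=1}^k y_j^{r_j} ν'(dy) | ≤ C · d_TV(ν, ν')^{1/2}, where d_TV(ν, ν') := sup{ |ν(A) − ν'(A)| : A ⊆ ℝ^k Borel } is the total variation distance. -/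
open MeasureTheory

/-- Total variation distance between two Borel measures on `ℝ^k`. -/
noncomputable def tvDist {k : ℕ} (ν ν' : Measure (Fin k → ℝ)) : ℝ :=
  sSup {d : ℝ | ∃ A : Set (Fin k → ℝ), MeasurableSet A ∧
    d = |(ν A).toReal - (ν' A).toReal|}

/-- Cauchy–Schwarz for the integral of a function against the constant `1`. -/
theorem sq_integral_le_measureReal_univ_mul {α : Type*} [MeasurableSpace α] (μ : Measure α)
    [IsFiniteMeasure μ] {f : α → ℝ} (hf : MemLp f 2 μ) :
    (∫ x, f x ∂μ) ^ 2 ≤ μ.real Set.univ * ∫ x, f x ^ 2 ∂μ := by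
  have hf1 : Integrable f μ := hf.integrable one_le_two
  have hf2 : Integrable (fun x => f x ^ 2) μ := hf.integrable_sq
  have key : ∀ t : ℝ, 0 ≤ (∫ x, f x ^ 2 ∂μ) + (-2 * t) * (∫ x, f x ∂μ)
      + μ.real Set.univ * t ^ 2 := by
    intro t
    have h0 : 0 ≤ ∫ x, (f x - t) ^ 2 ∂μ := integral_nonneg fun x => sq_nonneg _
    have h1 : ∫ x, (f x - t) ^ 2 ∂μ = ∫ x, (f x ^ 2 + (-2 * t) * f x) + t ^ 2 ∂μ := by
      congr 1
      ext x
      ring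
    have hlin : Integrable (fun x => f x ^ 2 + (-2 * t) * f x) μ := hf2.add (hf1.const_mul _)
    rw [h1, integral_add hlin (integrable_const _),
      integral_add hf2 (hf1.const_mul _), integral_const_mul, integral_const, smul_eq_mul] at h0
    exact h0
  have hd := discrim_le_zero (a := μ.real Set.univ) (b := -2 * ∫ x, f x ∂μ)
    (c := ∫ x, f x ^ 2 ∂μ) fun t => by linarith [key t]
  rw [discrim] at hd
  linarith

/-- If `μ' ≤ μ`, the integrals of a square-integrable function against the two measures differ
by at most the square root of the mass difference times the `L²` norm. -/
theorem abs_integral_sub_integral_le_of_measure_le {α : Type*} [MeasurableSpace α]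
    {μ μ' : Measure α} [IsFiniteMeasure μ] [IsFiniteMeasure μ'] (hle : μ' ≤ μ) {f : α → ℝ}
    (hf : MemLp f 2 μ) :
    |(∫ x, f x ∂μ) - ∫ x, f x ∂μ'| ≤
      √(μ.real Set.univ - μ'.real Set.univ) * √(∫ x, f x ^ 2 ∂μ) := by
  have hsub : μ - μ' ≤ μ := Measure.sub_le
  have hadd : μ - μ' + μ' = μ := Measure.sub_add_cancel_of_le hle
  have hf' : MemLp f 2 (μ - μ') := hf.mono_measure hsub
  have hint : (∫ x, f x ∂μ) = (∫ x, f x ∂(μ - μ')) + ∫ x, f x ∂μ' := by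
    conv_lhs => rw [← hadd]
    exact integral_add_measure (hf'.integrable one_le_two)
      ((hf.mono_measure hle).integrable one_le_two)
  have hmass : μ.real Set.univ = (μ - μ').real Set.univ + μ'.real Set.univ := by
    conv_lhs => rw [← hadd]
    exact measureReal_add_apply
  rw [hint, hmass, add_sub_cancel_right, add_sub_cancel_right, ← Real.sqrt_mul measureReal_nonneg]
  refine Real.abs_le_sqrt ((sq_integral_le_measureReal_univ_mul _ hf').trans ?_)
  exact mul_le_mul_of_nonneg_left
    (integral_mono_measure hsub (Filter.Eventually.of_forall fun x => sq_nonneg _) hf.integrable_sq)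
    measureReal_nonneg

theorem abs_measureReal_sub_le_tvDist {k : ℕ} (ν ν' : Measure (Fin k → ℝ))
    [IsProbabilityMeasure ν] [IsProbabilityMeasure ν'] {A : Set (Fin k → ℝ)}
    (hA : MeasurableSet A) : |ν.real A - ν'.real A| ≤ tvDist ν ν' := by
  refine le_csSup ⟨1, ?_⟩ ⟨A, hA, rfl⟩
  rintro d ⟨B, -, rfl⟩
  change |ν.real B - ν'.real B| ≤ 1
  have h1 : ν.real B ≤ 1 := measureReal_le_one
  have h2 : ν'.real B ≤ 1 := measureReal_le_one
  have h3 : 0 ≤ ν.real B := measureReal_nonneg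
  have h4 : 0 ≤ ν'.real B := measureReal_nonneg
  rw [abs_le]
  constructor <;> linarith

/-- On a set where `ν'` is dominated by `ν`, integrals against `ν` and `ν'` are close. -/
theorem abs_setIntegral_sub_le_sqrt_tvDist {k : ℕ} (ν ν' : Measure (Fin k → ℝ))
    [IsProbabilityMeasure ν] [IsProbabilityMeasure ν'] {s : Set (Fin k → ℝ)}
    (hs : MeasurableSet s) (hle : ∀ t, MeasurableSet t → t ⊆ s → ν' t ≤ ν t)
    {f : (Fin k → ℝ) → ℝ} (hf : MemLp f 2 ν) {K : ℝ} (hK : ∫ x, f x ^ 2 ∂ν ≤ K) :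
    |(∫ x in s, f x ∂ν) - ∫ x in s, f x ∂ν'| ≤ √(tvDist ν ν') * √K := by
  have hle' : ν'.restrict s ≤ ν.restrict s := by
    refine Measure.le_iff.2 fun t ht => ?_
    rw [Measure.restrict_apply ht, Measure.restrict_apply ht]
    exact hle _ (ht.inter hs) Set.inter_subset_right
  refine (abs_integral_sub_integral_le_of_measure_le hle' (hf.restrict s)).trans ?_
  rw [measureReal_restrict_apply_univ, measureReal_restrict_apply_univ]
  gcongr
  · exact (le_abs_self _).trans (abs_measureReal_sub_le_tvDist ν ν' hs)
  · exact (setIntegral_le_integral hf.integrable_sq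
      (Filter.Eventually.of_forall fun x => sq_nonneg _)).trans hK

theorem tvDist_comm {k : ℕ} (ν ν' : Measure (Fin k → ℝ)) : tvDist ν ν' = tvDist ν' ν := by
  simp only [tvDist, abs_sub_comm]

/-- Functions with second moments at most `K` under `ν` and `ν'` have integrals that differ by at
most `2 √(K d_TV(ν, ν'))`. -/
theorem abs_integral_sub_integral_le_sqrt_tvDist {k : ℕ} (ν ν' : Measure (Fin k → ℝ))
    [IsProbabilityMeasure ν] [IsProbabilityMeasure ν'] {f : (Fin k → ℝ) → ℝ}
    (hf : MemLp f 2 ν) (hf' : MemLp f 2 ν') {K : ℝ} (hK : ∫ x, f x ^ 2 ∂ν ≤ K)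
    (hK' : ∫ x, f x ^ 2 ∂ν' ≤ K) :
    |(∫ x, f x ∂ν) - ∫ x, f x ∂ν'| ≤ 2 * √K * √(tvDist ν ν') := by
  obtain ⟨s, hs, h1, h2⟩ := hahn_decomposition ν ν'
  have b1 := abs_setIntegral_sub_le_sqrt_tvDist ν ν' hs h1 hf hK
  have b2 := abs_setIntegral_sub_le_sqrt_tvDist ν' ν hs.compl h2 hf' hK'
  rw [tvDist_comm ν' ν] at b2
  rw [← integral_add_compl hs (hf.integrable one_le_two),
    ← integral_add_compl hs (hf'.integrable one_le_two)]
  rw [abs_le] at *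
  constructor <;> linarith [b1.1, b1.2, b2.1, b2.2]

/-- A monomial of degree at most `m` is dominated by an exponential. -/
theorem sq_prod_pow_le_exp {k m : ℕ} {η : ℝ} (hη : 0 < η) {r : Fin k → ℕ}
    (hr : ∑ l, r l ≤ m) (y : Fin k → ℝ) :
    (∏ l, y l ^ r l) ^ 2 ≤
      ((m.factorial : ℝ) * (1 + 2 / η) ^ m) ^ 2 * Real.exp (η * ∑ l, |y l|) := by
  set S := ∑ l, |y l| with hS
  set R := ∑ l, r l with hR
  have hS0 : 0 ≤ S := Finset.sum_nonneg fun l _ => abs_nonneg _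
  have hprod : |∏ l, y l ^ r l| ≤ S ^ R := by
    rw [Finset.abs_prod, hR, ← Finset.prod_pow_eq_pow_sum]
    refine Finset.prod_le_prod (fun l _ => abs_nonneg _) fun l _ => ?_
    rw [abs_pow]
    exact pow_le_pow_left₀ (abs_nonneg _)
      (Finset.single_le_sum (f := fun l => |y l|) (fun _ _ => abs_nonneg _) (Finset.mem_univ l)) _
  have hexp : (η / 2 * S) ^ R ≤ R.factorial * Real.exp (η / 2 * S) := by
    have h := Real.pow_div_factorial_le_exp (η / 2 * S) (by positivity) R
    rwa [div_le_iff₀' (by positivity)] at h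
  have hpow : S ^ R = (2 / η) ^ R * (η / 2 * S) ^ R := by
    rw [← mul_pow]
    congr 1
    field_simp
  have hη2 : 0 ≤ 2 / η := by positivity
  have hconst : (2 / η) ^ R ≤ (1 + 2 / η) ^ m :=
    (pow_le_pow_left₀ hη2 (by linarith) R).trans (pow_le_pow_right₀ (by linarith) hr)
  have hfac : (R.factorial : ℝ) ≤ m.factorial := by exact_mod_cast Nat.factorial_le hr
  have hbound : |∏ l, y l ^ r l| ≤
      (m.factorial : ℝ) * (1 + 2 / η) ^ m * Real.exp (η / 2 * S) := by
    calc |∏ l, y l ^ r l| ≤ (2 / η) ^ R * (η / 2 * S) ^ R := hprod.trans_eq hpow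
      _ ≤ (1 + 2 / η) ^ m * (m.factorial * Real.exp (η / 2 * S)) := by
        gcongr
        exact hexp.trans (by gcongr)
      _ = _ := by ring
  rw [← sq_abs]
  refine (pow_le_pow_left₀ (abs_nonneg _) hbound 2).trans_eq ?_
  rw [mul_pow, ← Real.exp_nat_mul]
  congr 2
  push_cast
  ring

/-- A function whose square is dominated by an exponential with bounded integral is square
integrable, with the corresponding bound. -/
theorem memLp_two_and_integral_sq_le {α : Type*} [MeasurableSpace α] {μ : Measure α}
    {f g : α → ℝ} (hf : AEStronglyMeasurable f μ) (hg : AEStronglyMeasurable g μ)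
    (hg0 : ∀ x, 0 ≤ g x) {B M : ℝ} (hM : 0 ≤ M) (hB : 0 ≤ B) (hfg : ∀ x, f x ^ 2 ≤ B * g x)
    (hgM : ∫⁻ x, ENNReal.ofReal (g x) ∂μ ≤ ENNReal.ofReal M) :
    MemLp f 2 μ ∧ ∫ x, f x ^ 2 ∂μ ≤ B * M := by
  have hgi : Integrable g μ := by
    refine ⟨hg, ?_⟩
    rw [hasFiniteIntegral_iff_ofReal (Filter.Eventually.of_forall hg0)]
    exact hgM.trans_lt ENNReal.ofReal_lt_top
  have hfi : Integrable (fun x => f x ^ 2) μ := by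
    refine (hgi.const_mul B).mono' (hf.pow 2) (Filter.Eventually.of_forall fun x => ?_)
    rw [Real.norm_of_nonneg (sq_nonneg _)]
    exact hfg x
  have hgle : ∫ x, g x ∂μ ≤ M := by
    rw [integral_eq_lintegral_of_nonneg_ae (Filter.Eventually.of_forall hg0) hg]
    exact ENNReal.toReal_le_of_le_ofReal hM hgM
  refine ⟨(memLp_two_iff_integrable_sq hf).2 hfi, ?_⟩
  calc ∫ x, f x ^ 2 ∂μ ≤ ∫ x, B * g x ∂μ := integral_mono hfi (hgi.const_mul B) hfg
    _ = B * ∫ x, g x ∂μ := integral_const_mul _ _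
    _ ≤ B * M := mul_le_mul_of_nonneg_left hgle hB

/-- Joint moments up to a fixed total degree of two probability measures on `ℝ^k` with
uniform exponential moments differ by at most a constant multiple of the square root of
their total variation distance. -/
theorem moments_close_of_total_variation_close
    (k m : ℕ) (hk : 1 ≤ k) (η M : ℝ) (hη : 0 < η) (hM : 1 ≤ M) :
    ∃ C : ℝ, 0 < C ∧
      ∀ ν ν' : Measure (Fin k → ℝ), IsProbabilityMeasure ν → IsProbabilityMeasure ν' →
      (∫⁻ y, ENNReal.ofReal (Real.exp (η * ∑ l, |y l|)) ∂ν ≤ ENNReal.ofReal M) →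
      (∫⁻ y, ENNReal.ofReal (Real.exp (η * ∑ l, |y l|)) ∂ν' ≤ ENNReal.ofReal M) →
      ∀ r : Fin k → ℕ, (∑ l, r l) ≤ m →
      |(∫ y, ∏ l, (y l) ^ (r l) ∂ν) - ∫ y, ∏ l, (y l) ^ (r l) ∂ν'| ≤
        C * Real.sqrt (tvDist ν ν') := by
  set B : ℝ := ((m.factorial : ℝ) * (1 + 2 / η) ^ m) ^ 2 with hB
  have hB0 : 0 < B := by positivity
  have hM0 : 0 < M := by linarith
  refine ⟨2 * √(B * M), by positivity, fun ν ν' _ _ hν hν' r hr => ?_⟩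
  have hbound : ∀ μ : Measure (Fin k → ℝ),
      (∫⁻ y, ENNReal.ofReal (Real.exp (η * ∑ l, |y l|)) ∂μ ≤ ENNReal.ofReal M) →
      MemLp (fun y : Fin k → ℝ => ∏ l, y l ^ r l) 2 μ ∧
        ∫ y, (∏ l, y l ^ r l) ^ 2 ∂μ ≤ B * M := fun μ hμ =>
    memLp_two_and_integral_sq_le
      (Continuous.aestronglyMeasurable (by fun_prop))
      (Continuous.aestronglyMeasurable (by fun_prop))
      (fun y => (Real.exp_pos _).le) hM0.le hB0.le (sq_prod_pow_le_exp hη hr) hμ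
  exact abs_integral_sub_integral_le_sqrt_tvDist ν ν' (hbound ν hν).1 (hbound ν' hν').1
    (hbound ν hν).2 (hbound ν' hν').2
end
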